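/- arXiv:2109.04523 — 3 statements merged into one kernel-verified Lean document; each statement's English description precedes it below -/
import Mathlib

section
/- Let β be an ordinal and let f be a function from the ordinals below ω^β (ordinal exponentiation) to Bool. Then there exists a set A of ordinals with A ⊆ {o : Ordinal | o < ω^β}, such that the order type of A equals ω^β and f is constant on A (i.e., the image f '' A has exactly one element, provided β ≥ 0 and ω^β > 0). -/
open Ordinal

universe u

/-- The order type of a set `A` of ordinals: the unique ordinal `o` (in the same
universe) whose lift equals the ordinal type of `(A, <)`.  Such an `o` exists for
every bounded set of ordinals, i.e. for every set-theoretic set of ordinals. -/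
noncomputable def otp (A : Set Ordinal.{u}) : Ordinal.{u} :=
  sInf {o : Ordinal.{u} | Ordinal.lift.{u+1, u} o = Ordinal.type ((· < ·) : A → A → Prop)}

namespace Ordinal

/-- The order type of a set of ordinals, in the successor universe. -/
noncomputable def setType (A : Set Ordinal.{u}) : Ordinal.{u + 1} :=
  type ((· < ·) : A → A → Prop)

theorem setType_mono {A B : Set Ordinal.{u}} (h : A ⊆ B) : setType A ≤ setType B :=
  type_le_iff'.2 ⟨⟨⟨Set.inclusion h, Set.inclusion_injective h⟩, Iff.rfl⟩⟩

theorem setType_Iio (o : Ordinal.{u}) : setType (Set.Iio o) = lift.{u + 1, u} o :=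
  type_lt_Iio o

theorem setType_add_le (A : Set Ordinal.{u}) (x : Ordinal.{u}) :
    setType (A ∩ Set.Iio x) + setType {y | x + y ∈ A} ≤ setType A := by
  unfold setType
  rw [← type_sum_lex, type_le_iff']
  let g : ↥(A ∩ Set.Iio x) ⊕ ↥{y | x + y ∈ A} → A :=
    Sum.elim (fun a => ⟨a.1, a.2.1⟩) (fun y => ⟨x + y.1, y.2⟩)
  refine ⟨RelEmbedding.ofMonotone g ?_⟩
  rintro _ _ (h | h | ⟨a, b⟩)
  · exact h
  · exact Subtype.mk_lt_mk.2 (add_lt_add_right (Subtype.coe_lt_coe.2 h) x)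
  · exact Subtype.mk_lt_mk.2 (lt_of_lt_of_le a.2.2 le_self_add)

theorem exists_add_eq_mul_le_setType {o : Ordinal.{u}}
    (ho : ∀ f : Ordinal.{u} → Bool, ∃ b, lift.{u + 1, u} o ≤ setType {y | y < o ∧ f y = b})
    (f : Ordinal.{u} → Bool) (n : ℕ) :
    ∃ k : Bool → ℕ, k true + k false = n ∧
      ∀ b, lift.{u + 1, u} (o * k b) ≤ setType {y | y < o * n ∧ f y = b} := by
  induction n with
  | zero => exact ⟨fun _ => 0, by simp⟩
  | succ n ih =>
    obtain ⟨k, hk, hkf⟩ := ih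
    obtain ⟨c, hc⟩ := ho fun y => f (o * n + y)
    have hmul (m : ℕ) : o * ((m + 1 : ℕ) : Ordinal) = o * m + o := by
      rw [Nat.cast_succ, mul_add_one]
    refine ⟨Function.update k c (k c + 1), ?_, fun b => ?_⟩
    · cases c <;> simp <;> omega
    · rcases eq_or_ne b c with rfl | hb
      · rw [Function.update_self, hmul, hmul, lift_add]
        refine (add_le_add (hkf b) hc).trans
          (le_trans (add_le_add (setType_mono ?_) (setType_mono ?_)) (setType_add_le _ (o * n)))
        · exact fun y hy => ⟨⟨hy.1.trans_le le_self_add, hy.2⟩, hy.1⟩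
        · exact fun y hy => ⟨add_lt_add_right hy.1 _, hy.2⟩
      · rw [Function.update_of_ne hb, hmul]
        exact (hkf b).trans (setType_mono fun y hy => ⟨hy.1.trans_le le_self_add, hy.2⟩)

theorem exists_opow_le_setType (β : Ordinal.{u}) (f : Ordinal.{u} → Bool) :
    ∃ b, lift.{u + 1, u} (ω ^ β) ≤ setType {y | y < ω ^ β ∧ f y = b} := by
  induction β using limitRecOn generalizing f with
  | zero =>
    refine ⟨f 0, ?_⟩
    rw [opow_zero, ← setType_Iio]
    refine setType_mono fun y hy => ⟨hy, ?_⟩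
    rw [Order.lt_one_iff.1 (Set.mem_Iio.1 hy)]
  | add_one γ ih =>
    by_contra! h
    have key (b : Bool) : ∃ n : ℕ,
        setType {y | y < ω ^ (γ + 1) ∧ f y = b} < lift.{u + 1, u} (ω ^ γ * n) := by
      obtain ⟨t, hlt, ht⟩ := lt_lift_iff.1 (h b)
      rw [opow_add_one, lt_mul_iff_of_isSuccLimit isSuccLimit_omega0] at hlt
      obtain ⟨m, hm, hlt⟩ := hlt
      obtain ⟨n, rfl⟩ := lt_omega0.1 hm
      exact ⟨n, ht ▸ lift_lt.2 hlt⟩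
    choose n hn using key
    obtain ⟨k, hk, hkf⟩ := exists_add_eq_mul_le_setType ih f (n true + n false)
    have hle (m : ℕ) : ω ^ γ * m ≤ ω ^ (γ + 1) := by
      rw [opow_add_one]
      exact mul_le_mul_right (natCast_lt_omega0 m).le _
    have hlt (b : Bool) : k b < n b := by
      have hsub : {y | y < ω ^ γ * (n true + n false : ℕ) ∧ f y = b} ⊆
          {y | y < ω ^ (γ + 1) ∧ f y = b} := fun y hy => ⟨hy.1.trans_le (hle _), hy.2⟩
      have := ((hkf b).trans (setType_mono hsub)).trans_lt (hn b)
      exact Nat.cast_lt.1 (lt_of_mul_lt_mul_left' (lift_lt.1 this))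
    have := hlt true
    have := hlt false
    omega
  | limit β hβ ih =>
    by_contra! h
    have key (b : Bool) : ∃ γ < β,
        setType {y | y < ω ^ β ∧ f y = b} < lift.{u + 1, u} (ω ^ γ) := by
      obtain ⟨t, hlt, ht⟩ := lt_lift_iff.1 (h b)
      obtain ⟨γ, hγ, hlt⟩ := (lt_opow_of_isSuccLimit omega0_ne_zero hβ).1 hlt
      exact ⟨γ, hγ, ht ▸ lift_lt.2 hlt⟩
    choose γ hγ hlt using key
    have hmax : max (γ true) (γ false) < β := max_lt (hγ _) (hγ _)
    obtain ⟨b, hb⟩ := ih _ hmax f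
    have hle : γ b ≤ max (γ true) (γ false) := by cases b <;> simp
    refine (hlt b).not_ge (le_trans (lift_le.2 (opow_le_opow_right omega0_pos hle))
      (hb.trans (setType_mono fun y hy => ⟨hy.1.trans ?_, hy.2⟩)))
    exact (opow_lt_opow_iff_right one_lt_omega0).2 hmax

end Ordinal

theorem otp_eq_of_setType_eq {A : Set Ordinal.{u}} {o : Ordinal.{u}}
    (h : setType A = Ordinal.lift.{u + 1, u} o) : otp A = o := by
  have : {p : Ordinal.{u} | Ordinal.lift.{u + 1, u} p = setType A} = {o} := by
    ext p
    simp [h]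
  rw [otp, ← setType, this, csInf_singleton]

/-- For every ordinal `β` and every 2-coloring `f` of the ordinals below `ω ^ β`
(ordinal exponentiation), there is a subset `A` of `{o | o < ω ^ β}` of full order
type `ω ^ β` on which `f` is constant: the image `f '' A` is a singleton. -/
theorem exists_full_otp_subset_monochromatic (β : Ordinal) (f : Ordinal → Bool) :
    ∃ A : Set Ordinal, A ⊆ {o : Ordinal | o < ω ^ β} ∧ otp A = ω ^ β ∧
      ∃ b : Bool, f '' A = {b} := by
  obtain ⟨b, hb⟩ := exists_opow_le_setType β f
  have hsub : {y | y < ω ^ β ∧ f y = b} ⊆ Set.Iio (ω ^ β) := fun y hy => hy.1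
  refine ⟨_, hsub, otp_eq_of_setType_eq
    (le_antisymm ((setType_mono hsub).trans_eq (setType_Iio _)) hb), b, ?_⟩
  have hne : {y | y < ω ^ β ∧ f y = b}.Nonempty := by
    by_contra hne
    rw [Set.not_nonempty_iff_eq_empty] at hne
    have hpos : 0 < ω ^ β := opow_pos β omega0_pos
    rw [hne] at hb
    exact (lift_lt.2 hpos).not_ge (hb.trans (by simp [setType]))
  obtain ⟨x, hx⟩ := hne
  exact Set.Subset.antisymm (Set.image_subset_iff.2 fun y hy => hy.2)
    (Set.singleton_subset_iff.2 ⟨x, hx, hx.2⟩)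
end

section
/- Let γ be an ordinal and m, k natural numbers. If A and B are sets of ordinals with otp(A) < ω^γ · m and otp(B) < ω^γ · k, then otp(A ∪ B) < ω^γ · (m + k). -/
open Ordinal

universe u

open Order in
/-- The natural (Hessenberg) sum of two ordinals. -/
noncomputable def natSum (a b : Ordinal.{u}) : Ordinal.{u} :=
  max (⨆ x : Set.Iio a, succ (natSum x.1 b)) (⨆ x : Set.Iio b, succ (natSum a x.1))
termination_by (a, b)
decreasing_by all_goals cases x; decreasing_tactic

theorem natSum_le_iff {a b c : Ordinal.{u}} :
    natSum a b ≤ c ↔ (∀ a' < a, natSum a' b < c) ∧ ∀ b' < b, natSum a b' < c := by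
  rw [natSum]
  simp [Ordinal.iSup_le_iff]

theorem natSum_lt_natSum_left {a' a : Ordinal.{u}} (h : a' < a) (b : Ordinal.{u}) :
    natSum a' b < natSum a b :=
  (natSum_le_iff.1 le_rfl).1 a' h

theorem natSum_lt_natSum_right {b' b : Ordinal.{u}} (a : Ordinal.{u}) (h : b' < b) :
    natSum a b' < natSum a b :=
  (natSum_le_iff.1 le_rfl).2 b' h

theorem natSum_le_natSum_left {a' a : Ordinal.{u}} (h : a' ≤ a) (b : Ordinal.{u}) :
    natSum a' b ≤ natSum a b :=
  StrictMono.monotone (fun _ _ h => natSum_lt_natSum_left h b) h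

theorem natSum_le_natSum_right {b' b : Ordinal.{u}} (a : Ordinal.{u}) (h : b' ≤ b) :
    natSum a b' ≤ natSum a b :=
  StrictMono.monotone (fun _ _ h => natSum_lt_natSum_right a h) h

/-- An ordinal below `o * p + r` with `r < o` either has a smaller quotient by `o`, or the same
quotient and a smaller remainder. -/
theorem lt_mul_natCast_add {o r c : Ordinal.{u}} {p : ℕ} (hr : r < o) (hc : c < o * p + r) :
    ∃ p' : ℕ, ∃ r' < o, c = o * p' + r' ∧ (p' < p ∨ p' = p ∧ r' < r) := by
  have h : c < o * ((p + 1 : ℕ) : Ordinal) := by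
    rw [Nat.cast_add, Nat.cast_one, mul_add_one]
    exact hc.trans (by gcongr)
  obtain ⟨q, hq, r', hr', rfl⟩ := lt_mul_iff.1 h
  obtain ⟨p', rfl⟩ := lt_omega0.1 (hq.trans (natCast_lt_omega0 _))
  refine ⟨p', r', hr', rfl, ?_⟩
  have hp : p' ≤ p := Nat.lt_succ_iff.1 (by exact_mod_cast hq)
  rcases hp.lt_or_eq with hp | rfl
  · exact .inl hp
  · exact .inr ⟨rfl, by simpa using hc⟩

theorem mul_natCast_add_lt {o r : Ordinal.{u}} {p q : ℕ} (hr : r < o) (h : p < q) :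
    o * p + r < o * q :=
  lt_mul_iff.2 ⟨p, by exact_mod_cast h, r, hr, rfl⟩

theorem natSum_mul_natCast_add_le {o : Ordinal.{u}}
    (ho : ∀ r < o, ∀ s < o, natSum r s < o) {r s : Ordinal.{u}} (p q : ℕ)
    (hr : r < o) (hs : s < o) :
    natSum (o * p + r) (o * q + s) ≤ o * ((p + q : ℕ) : Ordinal) + natSum r s := by
  rw [natSum_le_iff]
  constructor
  · intro a ha
    obtain ⟨p', r', hr', rfl, h | ⟨rfl, h⟩⟩ := lt_mul_natCast_add hr ha
    · exact (natSum_mul_natCast_add_le ho p' q hr' hs).trans_lt <|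
        (mul_natCast_add_lt (ho _ hr' _ hs) (by omega)).trans_le le_self_add
    · exact (natSum_mul_natCast_add_le ho p' q hr' hs).trans_lt <|
        add_lt_add_right (natSum_lt_natSum_left h s) _
  · intro b hb
    obtain ⟨q', s', hs', rfl, h | ⟨rfl, h⟩⟩ := lt_mul_natCast_add hs hb
    · exact (natSum_mul_natCast_add_le ho p q' hr hs').trans_lt <|
        (mul_natCast_add_lt (ho _ hr _ hs') (by omega)).trans_le le_self_add
    · exact (natSum_mul_natCast_add_le ho p q' hr hs').trans_lt <|
        add_lt_add_right (natSum_lt_natSum_right r h) _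
termination_by (o * p + r, o * q + s)
decreasing_by all_goals (subst_vars; first | exact Prod.Lex.left _ _ ha | exact Prod.Lex.right _ hb)

theorem natSum_lt_mul_natCast {o : Ordinal.{u}} (ho : ∀ r < o, ∀ s < o, natSum r s < o)
    {a b : Ordinal.{u}} {m k : ℕ} (ha : a < o * m) (hb : b < o * k) :
    natSum a b < o * ((m + k : ℕ) : Ordinal) := by
  obtain ⟨p, hp, r, hr, rfl⟩ := lt_mul_iff.1 ha
  obtain ⟨q, hq, s, hs, rfl⟩ := lt_mul_iff.1 hb
  obtain ⟨p, rfl⟩ := lt_omega0.1 (hp.trans (natCast_lt_omega0 _))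
  obtain ⟨q, rfl⟩ := lt_omega0.1 (hq.trans (natCast_lt_omega0 _))
  rw [Nat.cast_lt] at hp hq
  exact (natSum_mul_natCast_add_le ho p q hr hs).trans_lt
    (mul_natCast_add_lt (ho r hr s hs) (by omega))

theorem natSum_lt_omega0_opow (γ : Ordinal.{u}) :
    ∀ r < ω ^ γ, ∀ s < ω ^ γ, natSum r s < ω ^ γ := by
  induction γ using WellFoundedLT.induction with
  | ind γ ih =>
    intro r hr s hs
    rcases eq_or_ne γ 0 with rfl | hγ
    · rw [opow_zero, Order.lt_one_iff] at *
      subst hr hs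
      rw [← nonpos_iff_eq_zero, natSum_le_iff]
      simp
    · obtain ⟨c, hc, m, hm⟩ := (lt_omega0_opow hγ).1 hr
      obtain ⟨d, hd, k, hk⟩ := (lt_omega0_opow hγ).1 hs
      have hm' : r < ω ^ max c d * m := hm.trans_le (by
        gcongr
        · exact omega0_pos
        · exact le_max_left c d)
      have hk' : s < ω ^ max c d * k := hk.trans_le (by
        gcongr
        · exact omega0_pos
        · exact le_max_right c d)
      exact (natSum_lt_mul_natCast (ih _ (max_lt hc hd)) hm' hk').trans
        (opow_mul_lt_opow (natCast_lt_omega0 _) (max_lt hc hd))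

theorem exists_type_inter_Iio_eq {α : Type u} [LinearOrder α] [WellFoundedLT α] {S : Set α}
    {c : Ordinal.{u}} (hc : c < typeLT S) : ∃ x ∈ S, typeLT ↥(S ∩ Set.Iio x) = c := by
  obtain ⟨x, rfl⟩ := typein_surj _ hc
  refine ⟨x, x.2, ?_⟩
  rw [← type_Iio_lt]
  exact RelIso.ordinalType_congr
    { toFun := fun y => ⟨⟨y, y.2.1⟩, y.2.2⟩
      invFun := fun y => ⟨y.1, y.1.2, y.2⟩
      map_rel_iff' := Iff.rfl }

theorem type_inter_Iio_lt {α : Type u} [LinearOrder α] [WellFoundedLT α] {S : Set α} {x : α}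
    (hx : x ∈ S) : typeLT ↥(S ∩ Set.Iio x) < typeLT S := by
  refine lt_of_eq_of_lt ?_ (typein_lt_type (· < ·) (⟨x, hx⟩ : S))
  rw [← type_Iio_lt]
  exact RelIso.ordinalType_congr
    { toFun := fun y => ⟨⟨y, y.2.1⟩, y.2.2⟩
      invFun := fun y => ⟨y.1, y.1.2, y.2⟩
      map_rel_iff' := Iff.rfl }

theorem type_union_le_natSum {α : Type u} [LinearOrder α] [WellFoundedLT α] (S T : Set α) :
    typeLT ↥(S ∪ T) ≤ natSum (typeLT S) (typeLT T) := by
  induction h : typeLT ↥(S ∪ T) using WellFoundedLT.induction generalizing S T with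
  | ind o ih =>
    subst h
    refine le_of_forall_lt fun c hc => ?_
    obtain ⟨x, hx, rfl⟩ := exists_type_inter_Iio_eq hc
    have key := ih _ hc (S ∩ Set.Iio x) (T ∩ Set.Iio x) (by rw [Set.union_inter_distrib_right])
    rcases hx with hx | hx
    · exact key.trans_lt <| (natSum_lt_natSum_left (type_inter_Iio_lt hx) _).trans_le <|
        natSum_le_natSum_right _ (type_mono Set.inter_subset_left)
    · exact key.trans_lt <| (natSum_lt_natSum_right _ (type_inter_Iio_lt hx)).trans_le <|
        natSum_le_natSum_left (type_mono Set.inter_subset_left) _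

theorem otp_eq_of_lift_eq {A : Set Ordinal.{u}} {o : Ordinal.{u}}
    (h : Ordinal.lift.{u + 1} o = typeLT A) : otp A = o := by
  have : {o : Ordinal.{u} | Ordinal.lift.{u + 1, u} o = typeLT A} = {o} := by
    ext a
    simp [← h]
  rw [otp, this, csInf_singleton]

theorem otp_eq_zero_of_forall_lift_ne {A : Set Ordinal.{u}}
    (h : ∀ o : Ordinal.{u}, Ordinal.lift.{u + 1} o ≠ typeLT A) : otp A = 0 := by
  have : {o : Ordinal.{u} | Ordinal.lift.{u + 1, u} o = typeLT A} = ∅ :=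
    Set.eq_empty_of_forall_notMem h
  rw [otp, this, Ordinal.sInf_empty]

theorem otp_eq_type_preimage {α : Type u} [LinearOrder α] [WellFoundedLT α]
    (f : α ↪o Ordinal.{u}) {A : Set Ordinal.{u}} (hA : A ⊆ Set.range f) :
    otp A = typeLT ↥(f ⁻¹' A) := by
  apply otp_eq_of_lift_eq
  rw [← Ordinal.lift_id.{u + 1} (typeLT A), ← lift_umax.{u, u + 1}]
  refine lift_type_eq.{u, u + 1, u + 1}.2 ⟨⟨Equiv.ofBijective (fun x => ⟨f x, x.2⟩) ⟨?_, ?_⟩, ?_⟩⟩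
  · intro x y h
    exact Subtype.ext (f.injective (congrArg Subtype.val h))
  · rintro ⟨a, ha⟩
    obtain ⟨x, rfl⟩ := hA ha
    exact ⟨⟨x, ha⟩, rfl⟩
  · intro x y
    exact f.lt_iff_lt

theorem otp_union_le_natSum (A B : Set Ordinal.{u}) :
    otp (A ∪ B) ≤ natSum (otp A) (otp B) := by
  by_cases h : ∃ o : Ordinal.{u}, Ordinal.lift.{u + 1} o = typeLT ↥(A ∪ B)
  · obtain ⟨o, ho⟩ := h
    rw [← type_toType o, ← Ordinal.lift_id.{u + 1} (typeLT ↥(A ∪ B)), ← lift_umax.{u, u + 1}] at ho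
    obtain ⟨e⟩ := lift_type_eq.{u, u + 1, u + 1}.1 ho
    let f : o.ToType ↪o Ordinal.{u} :=
      OrderEmbedding.ofStrictMono (fun x => (e x : Ordinal)) fun _ _ h => e.map_rel_iff.2 h
    have hf : A ∪ B ⊆ Set.range f := fun a ha =>
      ⟨e.symm ⟨a, ha⟩, congrArg Subtype.val (e.apply_symm_apply ⟨a, ha⟩)⟩
    rw [otp_eq_type_preimage f hf, otp_eq_type_preimage f (Set.subset_union_left.trans hf),
      otp_eq_type_preimage f (Set.subset_union_right.trans hf)]
    exact type_union_le_natSum _ _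
  · rw [otp_eq_zero_of_forall_lift_ne (not_exists.1 h)]
    exact zero_le

/-- If `otp A < ω ^ γ · m` and `otp B < ω ^ γ · k` (ordinal arithmetic), then
`otp (A ∪ B) < ω ^ γ · (m + k)`. -/
theorem otp_union_lt_omega_pow_mul (γ : Ordinal) (m k : ℕ) (A B : Set Ordinal)
    (hA : otp A < ω ^ γ * (m : Ordinal)) (hB : otp B < ω ^ γ * (k : Ordinal)) :
    otp (A ∪ B) < ω ^ γ * ((m + k : ℕ) : Ordinal) := by
  exact (otp_union_le_natSum A B).trans_lt
    (natSum_lt_mul_natCast (natSum_lt_omega0_opow γ) hA hB)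
end

section
/- Let χ be an ordinal and let f be a function from the ordinals below χ to Bool. Then there exist a set A ⊆ {o : Ordinal | o < χ} with otp(A) = χ, a natural number n, a nondecreasing sequence of ordinals c₀ = 0 ≤ c₁ ≤ ⋯ ≤ cₙ = χ, and values b₀, …, b_{n-1} ∈ Bool such that, letting φ be the unique order isomorphism from {o : Ordinal | o < χ} onto A, for every i < n and every ordinal x with cᵢ ≤ x < c_{i+1}, we have f(φ(x)) = bᵢ. (That is, any 2-coloring of χ becomes piecewise constant on finitely many consecutive intervals after restricting to a subset of full order type.) -/
open Ordinal

universe u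

/-- If two monotone functions on the ordinals never stall simultaneously, then over any interval of
length `ω ^ α` at least one of them grows by `ω ^ α`. -/
theorem add_omega0_opow_le_or {u v : Ordinal.{u} → Ordinal.{u}} (hu : Monotone u) (hv : Monotone v)
    (huv : ∀ x y, x < y → u x < u y ∨ v x < v y) (α γ : Ordinal.{u}) :
    u γ + ω ^ α ≤ u (γ + ω ^ α) ∨ v γ + ω ^ α ≤ v (γ + ω ^ α) := by
  induction α using WellFoundedLT.induction generalizing γ with
  | ind α ih =>
    rcases eq_or_ne α 0 with rfl | hα
    · simpa using huv γ (γ + 1) (by simp)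
    by_contra! h
    obtain ⟨hp, hq⟩ := h
    have hpos : (0 : Ordinal) < ω ^ α := opow_pos _ omega0_pos
    obtain ⟨β, hβ, m, hm⟩ : ∃ β < α, ∃ m : ℕ,
        u (γ + ω ^ α) < u γ + ω ^ β * m ∧ v (γ + ω ^ α) < v γ + ω ^ β * m := by
      obtain ⟨p, hpα, hp'⟩ := (lt_add_iff hpos.ne').1 hp
      obtain ⟨q, hqα, hq'⟩ := (lt_add_iff hpos.ne').1 hq
      obtain ⟨β, hβ, m, hm⟩ := (lt_omega0_opow hα).1 (max_lt hpα hqα)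
      refine ⟨β, hβ, m, hp'.trans_lt ?_, hq'.trans_lt ?_⟩
      · simpa using (le_max_left p q).trans_lt hm
      · simpa using (le_max_right p q).trans_lt hm
    have blocks : ∀ k : ℕ, ∃ i j : ℕ, i + j = k ∧
        u γ + ω ^ β * i ≤ u (γ + ω ^ β * k) ∧ v γ + ω ^ β * j ≤ v (γ + ω ^ β * k) := by
      intro k
      induction k with
      | zero => exact ⟨0, 0, by simp⟩
      | succ k ihk =>
        obtain ⟨i, j, hij, hi, hj⟩ := ihk
        have hstep : γ + ω ^ β * (k + 1 : ℕ) = γ + ω ^ β * k + ω ^ β := by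
          rw [Nat.cast_succ, mul_add_one, add_assoc]
        have hle : γ + ω ^ β * k ≤ γ + ω ^ β * (k + 1 : ℕ) := by
          rw [hstep]; exact le_self_add
        rcases ih β hβ (γ + ω ^ β * k) with h | h
        · refine ⟨i + 1, j, by omega, ?_, hj.trans (hv hle)⟩
          rw [hstep, Nat.cast_succ, mul_add_one, ← add_assoc]
          exact (add_le_add_left hi _).trans h
        · refine ⟨i, j + 1, by omega, hi.trans (hu hle), ?_⟩
          rw [hstep, Nat.cast_succ, mul_add_one, ← add_assoc]
          exact (add_le_add_left hj _).trans h
    obtain ⟨i, j, hij, hi, hj⟩ := blocks (2 * m)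
    have hle : γ + ω ^ β * (2 * m : ℕ) ≤ γ + ω ^ α := by
      gcongr
      calc ω ^ β * (2 * m : ℕ) ≤ ω ^ β * ω := by gcongr; exact (natCast_lt_omega0 _).le
        _ = ω ^ (Order.succ β) := (opow_succ _ _).symm
        _ ≤ ω ^ α := opow_le_opow_right omega0_pos (Order.succ_le_of_lt hβ)
    rcases (by omega : m ≤ i ∨ m ≤ j) with h | h
    · refine (hm.1.trans_le ?_).false
      refine le_trans ?_ (hi.trans (hu hle))
      gcongr
    · refine (hm.2.trans_le ?_).false
      refine le_trans ?_ (hj.trans (hv hle))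
      gcongr

theorem not_bddAbove_union_Ici (S : Set Ordinal.{u}) (χ : Ordinal.{u}) :
    ¬ BddAbove (S ∪ Set.Ici χ) := by
  rintro ⟨B, hB⟩
  exact (Order.lt_succ (max B χ)).not_ge <| (hB (Or.inr ((le_max_right B χ).trans
    (Order.le_succ _)))).trans (le_max_left B χ)

/-- Pigeonhole principle for powers of `ω`: any 2-coloring has a color class of full order type. -/
theorem exists_monochromatic_enumOrd_lt (α : Ordinal.{u}) (f : Ordinal.{u} → Bool) :
    ∃ b : Bool, ∀ x < ω ^ α, enumOrd (f ⁻¹' {b} ∪ Set.Ici (ω ^ α)) x < ω ^ α := by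
  by_contra! h
  set χ : Ordinal.{u} := ω ^ α with hχ
  let E (b : Bool) : Ordinal.{u} → Ordinal.{u} := enumOrd (f ⁻¹' {b} ∪ Set.Ici χ)
  have hE (b : Bool) : StrictMono (E b) := enumOrd_strictMono (not_bddAbove_union_Ici _ _)
  let r (b : Bool) (x : Ordinal.{u}) : Ordinal.{u} := sInf {i | x ≤ E b i}
  have hne (b : Bool) (x : Ordinal.{u}) : {i | x ≤ E b i}.Nonempty := ⟨x, (hE b).le_apply⟩
  have hr_le {b : Bool} {x i : Ordinal.{u}} (hi : x ≤ E b i) : r b x ≤ i := csInf_le' hi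
  have hr (b : Bool) (x : Ordinal.{u}) : x ≤ E b (r b x) := csInf_mem (hne b x)
  have hmono (b : Bool) : Monotone (r b) := fun x y hxy ↦ hr_le (hxy.trans (hr b y))
  have hstrict (b : Bool) {x y : Ordinal.{u}} (hx : f x = b) (hxy : x < y) : r b x < r b y := by
    obtain ⟨i, hi⟩ := enumOrd_surjective (not_bddAbove_union_Ici (f ⁻¹' {b}) χ)
      (Or.inl hx : x ∈ f ⁻¹' {b} ∪ Set.Ici χ)
    refine (hr_le hi.ge).trans_lt ((hE b).lt_iff_lt.1 ?_)
    exact hi.trans_lt (hxy.trans_le (hr b y))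
  have hbound (b : Bool) : r b χ < χ := by
    obtain ⟨p, hp, hle⟩ := h b
    exact (hr_le hle).trans_lt hp
  have hsep : ∀ x y, x < y → r true x < r true y ∨ r false x < r false y := by
    intro x y hxy
    rcases hfx : f x with _ | _
    · exact Or.inr (hstrict _ hfx hxy)
    · exact Or.inl (hstrict _ hfx hxy)
  rcases add_omega0_opow_le_or (hmono true) (hmono false) hsep α 0 with h' | h' <;>
    rw [← hχ, zero_add] at h'
  · exact (hbound true).not_ge (le_add_self.trans h')
  · exact (hbound false).not_ge (le_add_self.trans h')

/-- Every 2-coloring of `χ` becomes piecewise constant after composing with a strictly monotone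
self-map of `χ`. -/
theorem exists_strictMonoOn_piecewise_constant (χ : Ordinal.{u}) (f : Ordinal.{u} → Bool) :
    ∃ (g : Ordinal.{u} → Ordinal.{u}) (n : ℕ) (c : ℕ → Ordinal.{u}) (b : ℕ → Bool),
      StrictMonoOn g (Set.Iio χ) ∧ Set.MapsTo g (Set.Iio χ) (Set.Iio χ) ∧
      c 0 = 0 ∧ c n = χ ∧ (∀ i < n, c i ≤ c (i + 1)) ∧
      ∀ i < n, ∀ x, c i ≤ x → x < c (i + 1) → f (g x) = b i := by
  induction χ using WellFoundedLT.induction generalizing f with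
  | ind χ ih =>
    by_cases hχ : IsPrincipal (· + ·) χ
    · rcases isPrincipal_add_iff_zero_or_omega0_opow.1 hχ with rfl | ⟨α, rfl⟩
      · exact ⟨id, 0, fun _ ↦ 0, fun _ ↦ true, by simp [StrictMonoOn, Set.MapsTo]⟩
      · obtain ⟨b, hb⟩ := exists_monochromatic_enumOrd_lt α f
        have hS := not_bddAbove_union_Ici (f ⁻¹' {b}) (ω ^ α)
        refine ⟨_, 1, fun i ↦ if i = 0 then 0 else ω ^ α, fun _ ↦ b,
          (enumOrd_strictMono hS).strictMonoOn _, hb, by simp, by simp, by simp, ?_⟩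
        intro i hi x _ hx
        have hx' : x < ω ^ α := by simpa using hx
        exact (enumOrd_mem hS x).resolve_right (hb x hx').not_ge
    · obtain ⟨a, ha, d, hd, rfl⟩ : ∃ a < χ, ∃ d < χ, a + d = χ := by
        simpa [isPrincipal_add_iff_add_lt_ne_self] using hχ
      obtain ⟨g₁, n₁, c₁, b₁, hg₁, hm₁, h0₁, hn₁, hc₁, hf₁⟩ := ih a ha f
      obtain ⟨g₂, n₂, c₂, b₂, hg₂, hm₂, h0₂, hn₂, hc₂, hf₂⟩ := ih d hd fun x ↦ f (a + x)
      have hc (i : ℕ) : (if n₁ + i ≤ n₁ then c₁ (n₁ + i) else a + c₂ (n₁ + i - n₁)) = a + c₂ i := by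
        rcases i with _ | i
        · simp [hn₁, h0₂]
        · simp
      have hsub {x : Ordinal.{u}} (hx : x < a + d) (hax : a ≤ x) : x - a < d := by
        rwa [← add_lt_add_iff_left a, Ordinal.add_sub_cancel_of_le hax]
      refine ⟨fun x ↦ if x < a then g₁ x else a + g₂ (x - a), n₁ + n₂,
        fun i ↦ if i ≤ n₁ then c₁ i else a + c₂ (i - n₁),
        fun i ↦ if i < n₁ then b₁ i else b₂ (i - n₁), ?_, ?_, by simp [h0₁], ?_, ?_, ?_⟩
      · intro x hx y hy hxy
        dsimp only
        split_ifs with hxa hya hya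
        · exact hg₁ hxa hya hxy
        · exact (hm₁ hxa).trans_le le_self_add
        · exact absurd (hxy.trans hya) hxa
        · rw [not_lt] at hxa hya
          rw [add_lt_add_iff_left]
          refine hg₂ (hsub hx hxa) (hsub hy hya) ?_
          rwa [← add_lt_add_iff_left a, Ordinal.add_sub_cancel_of_le hxa,
            Ordinal.add_sub_cancel_of_le hya]
      · intro x hx
        dsimp only
        split_ifs with hxa
        · exact (hm₁ hxa).trans ha
        · exact (add_lt_add_iff_left a).2 (hm₂ (hsub hx (not_lt.1 hxa)))
      · dsimp only
        rw [hc, hn₂]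
      · intro i hi
        dsimp only
        rcases lt_or_ge i n₁ with h | h
        · simpa [h.le, Nat.succ_le_of_lt h] using hc₁ i h
        · obtain ⟨j, rfl⟩ := Nat.exists_eq_add_of_le h
          rw [add_assoc, hc, hc]
          exact add_le_add_right (hc₂ j (by omega)) a
      · intro i hi x hix hxi
        dsimp only at hix hxi ⊢
        rcases lt_or_ge i n₁ with h | h
        · rw [if_pos h.le] at hix
          rw [if_pos (Nat.succ_le_of_lt h)] at hxi
          have hxa : x < a := by
            rw [← hn₁]
            exact hxi.trans_le (Nat.decreasingInduction (motive := fun m _ ↦ c₁ m ≤ c₁ n₁)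
              (fun k hk hle ↦ (hc₁ k hk).trans hle) le_rfl (Nat.succ_le_of_lt h))
          rw [if_pos hxa, if_pos h]
          exact hf₁ i h x hix hxi
        · obtain ⟨j, rfl⟩ := Nat.exists_eq_add_of_le h
          rw [hc] at hix
          rw [add_assoc, hc] at hxi
          have hax : a ≤ x := le_self_add.trans hix
          rw [if_neg hax.not_gt, if_neg h.not_gt, Nat.add_sub_cancel_left]
          refine hf₂ j (by omega) _ ?_ ?_
          · rwa [← add_le_add_iff_left a, Ordinal.add_sub_cancel_of_le hax]
          · rwa [← add_lt_add_iff_left a, Ordinal.add_sub_cancel_of_le hax]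

theorem otp_image_Iio {g : Ordinal.{u} → Ordinal.{u}} {χ : Ordinal.{u}}
    (hg : StrictMonoOn g (Set.Iio χ)) : otp (g '' Set.Iio χ) = χ := by
  have htype : Ordinal.type ((· < ·) : g '' Set.Iio χ → g '' Set.Iio χ → Prop) =
      Ordinal.lift.{u + 1, u} χ := by
    rw [← type_lt_Iio]
    exact (hg.orderIso g _).symm.toRelIsoLT.ordinalType_congr
  simp [otp, htype]

/-- Any 2-coloring `f` of the ordinals below `χ` becomes piecewise constant on
finitely many consecutive intervals after restricting to a subset `A` of full order
type `χ`: there are `n`, a nondecreasing sequence `0 = c 0 ≤ c 1 ≤ ⋯ ≤ c n = χ`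
and booleans `b 0, …, b (n-1)` such that for the (unique) order isomorphism `φ`
from `{o | o < χ}` onto `A`, whenever `c i ≤ x < c (i+1)` we have `f (φ x) = b i`. -/
theorem exists_piecewise_monochromatic_subset (χ : Ordinal) (f : Ordinal → Bool) :
    ∃ (A : Set Ordinal) (n : ℕ) (c : ℕ → Ordinal) (b : ℕ → Bool),
      A ⊆ {o : Ordinal | o < χ} ∧ otp A = χ ∧
      c 0 = 0 ∧ c n = χ ∧ (∀ i < n, c i ≤ c (i + 1)) ∧
      ∀ φ : ({o : Ordinal | o < χ} ≃o A),
        ∀ i < n, ∀ x : {o : Ordinal | o < χ},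
          c i ≤ x.1 → x.1 < c (i + 1) → f ((φ x : A) : Ordinal) = b i := by
  obtain ⟨g, n, c, b, hg, hm, h0, hn, hc, hf⟩ := exists_strictMonoOn_piecewise_constant χ f
  refine ⟨g '' Set.Iio χ, n, c, b, hm.image_subset, otp_image_Iio hg, h0, hn, hc, ?_⟩
  intro φ i hi x hix hxi
  rw [Subsingleton.elim φ (hg.orderIso g _)]
  exact hf i hi x hix hxi
end
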